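/- arXiv:2407.03574 — 2 statements merged into one kernel-verified Lean document; each statement's English description precedes it below -/
import Mathlib

section
/- Let f : Ω → [0, ∞) be continuous with supp(f) having connected interior. If f admits an axiom cluster tree, then the Hartigan tree H_f, equipped with the height h_f, is itself an axiom cluster tree for f. -/
open Set Topology Bornology ENNReal

/-- Two sets are neighbors if the interior of the union of their closures is connected
(the empty set being considered disconnected). -/
def Neighbors {Ω : Type*} [TopologicalSpace Ω] (A B : Set Ω) : Prop :=
  IsConnected (interior (closure A ∪ closure B))

/-- The piecewise constant function `f = ∑ i, lam i * 1_{A i}`. -/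
noncomputable def pwConst {Ω : Type*} (m : ℕ) (A : Fin m → Set Ω) (lam : Fin m → ℝ) :
    Ω → ℝ :=
  fun x => ∑ i, Set.indicator (A i) (fun _ => lam i) x

/-- Membership in the class `F`: `f = ∑_{i=1}^m lam i * 1_{A i}` where each `lam i > 0`,
the `A i` are pairwise disjoint, bounded, connected sets with connected interior, and
`supp f = ⋃ i, closure (A i)` has connected interior. -/
def MemF {Ω : Type*} [MetricSpace Ω] (m : ℕ) (A : Fin m → Set Ω) (lam : Fin m → ℝ) : Prop :=
  (∀ i, 0 < lam i) ∧
  (Pairwise fun i j => Disjoint (A i) (A j)) ∧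
  (∀ i, IsBounded (A i)) ∧
  (∀ i, IsConnected (A i)) ∧
  (∀ i, IsConnected (interior (A i))) ∧
  IsConnected (interior (⋃ i, closure (A i)))

/-- The neighborhood `N(A i)` of a region: the union of all regions `A j` that are
neighbors of `A i`. -/
def regionNbhd {Ω : Type*} [TopologicalSpace Ω] {m : ℕ} (A : Fin m → Set Ω) (i : Fin m) :
    Set Ω :=
  ⋃ j ∈ {j | Neighbors (A i) (A j)}, A j

/-- A set `C` satisfies the axioms (A1), (A2), (A3) for `f = ∑ i, lam i * 1_{A i}`:
(A2) `C = ⋃_{i ∈ I} A i` for some `I`;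
(A1) any two regions of `C` are joined by a chain of neighboring regions inside `C`;
(A3) `inf_{x ∈ C} f(x) > sup_{x ∈ N(C) ∖ C} f(x)` where `N(C) = ⋃_{i ∈ I} N(A i)`. -/
def SatisfiesAxioms {Ω : Type*} [MetricSpace Ω] (m : ℕ) (A : Fin m → Set Ω)
    (lam : Fin m → ℝ) (C : Set Ω) : Prop :=
  ∃ I : Set (Fin m),
    C = ⋃ i ∈ I, A i ∧
    (∀ i ∈ I, ∀ j ∈ I,
      Relation.ReflTransGen (fun a b => a ∈ I ∧ b ∈ I ∧ Neighbors (A a) (A b)) i j) ∧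
    sSup (pwConst m A lam '' ((⋃ i ∈ I, regionNbhd A i) \ C))
      < sInf (pwConst m A lam '' C)

/-- The collection `{A i}` has the internally connected property: whenever the union of
the closures of two of its members is connected, the interior of that union is
connected. -/
def InternallyConnectedFamily {Ω : Type*} [TopologicalSpace Ω] {m : ℕ}
    (A : Fin m → Set Ω) : Prop :=
  ∀ i j, IsConnected (closure (A i) ∪ closure (A j)) →
    IsConnected (interior (closure (A i) ∪ closure (A j)))

/-- The Hartigan cluster tree of `f`: the collection of all connected components of the
upper level sets `{x | f x ≥ lam}` over all `lam > 0`. -/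
def HartiganTree {Ω : Type*} [TopologicalSpace Ω] (f : Ω → ℝ) : Set (Set Ω) :=
  {C | ∃ lam > (0 : ℝ), ∃ x ∈ {y | lam ≤ f y}, C = connectedComponentIn {y | lam ≤ f y} x}

/-- The natural height function `h_f(C) = inf_{x ∈ C} f x`. -/
noncomputable def heightFn {Ω : Type*} (f : Ω → ℝ) (C : Set Ω) : ℝ := sInf (f '' C)

/-- The merge height of `x` and `y` in the dendrogram `(T, h)`:
`m_{(T,h)}(x,y) = sup {h C : C ∈ T, x ∈ C, y ∈ C}`. -/
noncomputable def mergeHeight {Ω : Type*} (T : Set (Set Ω)) (h : Set Ω → ℝ) (x y : Ω) :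
    ℝ :=
  sSup {t | ∃ C ∈ T, x ∈ C ∧ y ∈ C ∧ t = h C}

/-- The merge distortion distance between two dendrograms:
`d_M = sup_{x,y} |m_{(T,h)}(x,y) − m_{(T',h')}(x,y)|` (valued in `[0,∞]`). -/
noncomputable def mergeDistortion {Ω : Type*} (T : Set (Set Ω)) (h : Set Ω → ℝ)
    (T' : Set (Set Ω)) (h' : Set Ω → ℝ) : ℝ≥0∞ :=
  ⨆ x : Ω, ⨆ y : Ω, edist (mergeHeight T h x y) (mergeHeight T' h' x y)

/-- The supremum distance `‖f − g‖_∞` (valued in `[0,∞]`). -/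
noncomputable def supDist {Ω : Type*} (f g : Ω → ℝ) : ℝ≥0∞ := ⨆ x : Ω, edist (f x) (g x)

/-- A cluster tree of a function `f`: a collection of connected subsets of `supp f`
any two of which are disjoint or nested. -/
def IsClusterTree {Ω : Type*} [TopologicalSpace Ω] (f : Ω → ℝ) (T : Set (Set Ω)) : Prop :=
  (∀ C ∈ T, C ⊆ closure (Function.support f) ∧ IsConnected C) ∧
  (∀ C ∈ T, ∀ C' ∈ T, Disjoint C C' ∨ C ⊆ C' ∨ C' ⊆ C)

/-- `g` belongs to the class `F_int` with finest axiom cluster tree `T`: `g` is a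
piecewise constant function in `F` whose underlying family of regions has the internally
connected property, and `T` is the collection of all sets satisfying the axioms. -/
def MemFintWithTree {Ω : Type*} [MetricSpace Ω] (g : Ω → ℝ) (T : Set (Set Ω)) : Prop :=
  ∃ (m : ℕ) (A : Fin m → Set Ω) (lam : Fin m → ℝ),
    MemF m A lam ∧ InternallyConnectedFamily A ∧
    g = pwConst m A lam ∧ T = {C | SatisfiesAxioms m A lam C}

/-- `T` is an axiom cluster tree for `f`: `T` is a cluster tree of `f` and there is a
sequence `(f_n) ⊆ F_int` with `‖f_n − f‖_∞ → 0` whose finest axiom cluster trees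
`𝒞*_{f_n}` converge to `(T, h_f)` in merge distortion distance. -/
def IsAxiomClusterTree {Ω : Type*} [MetricSpace Ω] (f : Ω → ℝ) (T : Set (Set Ω)) : Prop :=
  IsClusterTree f T ∧
  ∃ (fn : ℕ → Ω → ℝ) (Tn : ℕ → Set (Set Ω)),
    (∀ n, MemFintWithTree (fn n) (Tn n)) ∧
    Filter.Tendsto (fun n => supDist (fn n) f) Filter.atTop (nhds 0) ∧
    Filter.Tendsto (fun n => mergeDistortion (Tn n) (heightFn (fn n)) T (heightFn f))
      Filter.atTop (nhds 0)

lemma hx_pw_eq {Ω : Type*} {m : ℕ} {A : Fin m → Set Ω} {lam : Fin m → ℝ}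
    (hd : Pairwise fun i j => Disjoint (A i) (A j)) {x : Ω} {i : Fin m} (hx : x ∈ A i) :
    pwConst m A lam x = lam i := by
  unfold pwConst
  rw [Finset.sum_eq_single i]
  · simp [hx]
  · intro j _ hj
    exact Set.indicator_of_notMem (fun h => Set.disjoint_left.1 (hd hj) h hx) _
  · simp

lemma hx_pw_pos {Ω : Type*} {m : ℕ} {A : Fin m → Set Ω} {lam : Fin m → ℝ} {x : Ω}
    (hx : 0 < pwConst m A lam x) : ∃ i, x ∈ A i := by
  by_contra! h
  have : pwConst m A lam x = 0 :=
    Finset.sum_eq_zero fun i _ => Set.indicator_of_notMem (h i) _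
  linarith

lemma hx_pw_nonneg {Ω : Type*} {m : ℕ} {A : Fin m → Set Ω} {lam : Fin m → ℝ}
    (hl : ∀ i, 0 < lam i) (x : Ω) : 0 ≤ pwConst m A lam x :=
  Finset.sum_nonneg fun i _ => Set.indicator_nonneg (fun _ _ => (hl i).le) _

lemma hx_bddBelow {Ω : Type*} {m : ℕ} {A : Fin m → Set Ω} {lam : Fin m → ℝ}
    (hl : ∀ i, 0 < lam i) (C : Set Ω) : BddBelow (pwConst m A lam '' C) :=
  ⟨0, by rintro _ ⟨x, _, rfl⟩; exact hx_pw_nonneg hl x⟩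

lemma hx_tree_lower {Ω : Type*} [MetricSpace Ω] {m : ℕ} {A : Fin m → Set Ω}
    {lam : Fin m → ℝ} (hl : ∀ i, 0 < lam i)
    (hd : Pairwise fun i j => Disjoint (A i) (A j)) {t : ℝ} (ht : 0 < t) {i j : Fin m}
    (hi : t ≤ lam i)
    (hij : Relation.ReflTransGen
      (fun a b => t ≤ lam a ∧ t ≤ lam b ∧ Neighbors (A a) (A b)) i j)
    {x y : Ω} (hx : x ∈ A i) (hy : y ∈ A j) :
    t ≤ mergeHeight {C | SatisfiesAxioms m A lam C} (heightFn (pwConst m A lam)) x y := by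
  set R : Fin m → Fin m → Prop :=
    fun a b => t ≤ lam a ∧ t ≤ lam b ∧ Neighbors (A a) (A b) with hR
  set I : Set (Fin m) := {k | Relation.ReflTransGen R i k} with hI
  set C : Set Ω := ⋃ k ∈ I, A k with hC
  have hIt : ∀ k ∈ I, t ≤ lam k := by
    intro k hk
    rcases Relation.ReflTransGen.cases_tail hk with h | ⟨c, _, h⟩
    · rw [h]; exact hi
    · exact h.2.1
  have hxC : x ∈ C := mem_biUnion (show i ∈ I from Relation.ReflTransGen.refl) hx
  have hyC : y ∈ C := mem_biUnion (show j ∈ I from hij) hy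
  have hge : t ≤ sInf (pwConst m A lam '' C) := by
    apply le_csInf ⟨_, mem_image_of_mem _ hxC⟩
    rintro _ ⟨z, hz, rfl⟩
    obtain ⟨k, hk, hzk⟩ := mem_iUnion₂.1 hz
    rw [hx_pw_eq hd hzk]
    exact hIt k hk
  have hsat : SatisfiesAxioms m A lam C := by
    refine ⟨I, rfl, ?_, lt_of_lt_of_le ?_ hge⟩
    · set S : Fin m → Fin m → Prop := fun a b => a ∈ I ∧ b ∈ I ∧ Neighbors (A a) (A b)
      have hsymm : Std.Symm S := ⟨fun a b h =>
        ⟨h.2.1, h.1, by have := h.2.2; unfold Neighbors at *; rwa [union_comm]⟩⟩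
      have key : ∀ a, a ∈ I → Relation.ReflTransGen S i a := by
        intro a ha
        have ha' : Relation.ReflTransGen R i a := ha
        clear ha
        induction ha' with
        | refl => exact Relation.ReflTransGen.refl
        | tail h1 h2 ih => exact ih.tail ⟨h1, h1.tail h2, h2.2.2⟩
      intro a ha b hb
      exact (Relation.ReflTransGen.stdSymm.symm _ _ (key a ha)).trans (key b hb)
    · have hval : ∀ v ∈ pwConst m A lam '' ((⋃ i ∈ I, regionNbhd A i) \ C),
          ∃ l, v = lam l ∧ v < t := by
        rintro _ ⟨z, ⟨hz, hzC⟩, rfl⟩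
        obtain ⟨a, ha, hza⟩ := mem_iUnion₂.1 hz
        obtain ⟨l, hl', hzl⟩ := mem_iUnion₂.1 hza
        refine ⟨l, hx_pw_eq hd hzl, ?_⟩
        rw [hx_pw_eq hd hzl]
        by_contra! hlt
        apply hzC
        have hlI : l ∈ I := Relation.ReflTransGen.tail ha ⟨hIt a ha, hlt, hl'⟩
        exact mem_biUnion hlI hzl
      rcases (pwConst m A lam '' ((⋃ i ∈ I, regionNbhd A i) \ C)).eq_empty_or_nonempty
        with h | h
      · rw [h, Real.sSup_empty]; exact ht
      · have hfin : (pwConst m A lam '' ((⋃ i ∈ I, regionNbhd A i) \ C)).Finite := by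
          apply (Set.finite_range lam).subset
          intro v hv
          obtain ⟨l, h1, _⟩ := hval v hv
          exact ⟨l, h1.symm⟩
        obtain ⟨_, _, h3⟩ := hval _ (h.csSup_mem hfin)
        exact h3
  refine le_trans hge (le_csSup ?_ ⟨C, hsat, hxC, hyC, rfl⟩)
  refine ⟨pwConst m A lam x, ?_⟩
  rintro _ ⟨D, _, hxD, _, rfl⟩
  exact csInf_le (hx_bddBelow hl D) ⟨x, hxD, rfl⟩

lemma hx_tree_nonneg {Ω : Type*} [MetricSpace Ω] {m : ℕ} {A : Fin m → Set Ω}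
    {lam : Fin m → ℝ} (hl : ∀ i, 0 < lam i) (T : Set (Set Ω)) (x y : Ω) :
    0 ≤ mergeHeight T (heightFn (pwConst m A lam)) x y := by
  apply Real.sSup_nonneg
  rintro _ ⟨C, _, _, _, rfl⟩
  apply Real.sInf_nonneg
  rintro _ ⟨z, _, rfl⟩
  exact hx_pw_nonneg hl z

lemma hx_hart_height {Ω : Type*} [TopologicalSpace Ω] {f : Ω → ℝ} {C : Set Ω}
    (hC : C ∈ HartiganTree f) : 0 < heightFn f C ∧ BddBelow (f '' C) ∧ IsPreconnected C := by
  obtain ⟨l, hl, x, hx, rfl⟩ := hC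
  have hb : ∀ v ∈ f '' connectedComponentIn {y | l ≤ f y} x, l ≤ v := by
    rintro _ ⟨z, hz, rfl⟩
    exact connectedComponentIn_subset {y | l ≤ f y} x hz
  refine ⟨lt_of_lt_of_le hl (le_csInf ⟨_, mem_image_of_mem _ (mem_connectedComponentIn hx)⟩ hb),
    ⟨l, hb⟩, isPreconnected_connectedComponentIn⟩

lemma hx_hart_nonneg {Ω : Type*} [TopologicalSpace Ω] (f : Ω → ℝ) (x y : Ω) :
    0 ≤ mergeHeight (HartiganTree f) (heightFn f) x y := by
  apply Real.sSup_nonneg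
  rintro _ ⟨C, hC, _, _, rfl⟩
  exact (hx_hart_height hC).1.le

lemma hx_hart_lower {Ω : Type*} [TopologicalSpace Ω] {f : Ω → ℝ} {K : Set Ω}
    (hK : IsPreconnected K) {t : ℝ} (ht : 0 < t) (hKt : ∀ z ∈ K, t ≤ f z) {x y : Ω}
    (hx : x ∈ K) (hy : y ∈ K) :
    t ≤ mergeHeight (HartiganTree f) (heightFn f) x y := by
  have hsub : K ⊆ connectedComponentIn {y | t ≤ f y} x :=
    hK.subset_connectedComponentIn hx hKt
  have hmem : connectedComponentIn {y | t ≤ f y} x ∈ HartiganTree f :=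
    ⟨t, ht, x, hKt x hx, rfl⟩
  have hle : t ≤ heightFn f (connectedComponentIn {y | t ≤ f y} x) := by
    apply le_csInf ⟨_, mem_image_of_mem _ (hsub hx)⟩
    rintro _ ⟨z, hz, rfl⟩
    exact connectedComponentIn_subset {y | t ≤ f y} x hz
  refine hle.trans (le_csSup ?_ ⟨_, hmem, hsub hx, hsub hy, rfl⟩)
  refine ⟨f x, ?_⟩
  rintro _ ⟨D, hD, hxD, _, rfl⟩
  exact csInf_le (hx_hart_height hD).2.1 ⟨x, hxD, rfl⟩

lemma hx_neighbors_inter {Ω : Type*} [TopologicalSpace Ω] {A B : Set Ω}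
    (hA : (interior A).Nonempty) (hB : (interior B).Nonempty) (h : Neighbors A B) :
    (closure A ∩ closure B).Nonempty := by
  have h2 := isPreconnected_closed_iff.1 h.isPreconnected (closure A) (closure B)
    isClosed_closure isClosed_closure interior_subset
  obtain ⟨a, ha⟩ := hA
  obtain ⟨b, hb⟩ := hB
  have ha' := interior_mono (subset_union_left.trans' subset_closure :
    A ⊆ closure A ∪ closure B) ha
  have hb' := interior_mono (subset_union_right.trans' subset_closure :
    B ⊆ closure A ∪ closure B) hb
  obtain ⟨z, _, hz⟩ := h2 ⟨a, ha', subset_closure (interior_subset ha)⟩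
    ⟨b, hb', subset_closure (interior_subset hb)⟩
  exact ⟨z, hz⟩

lemma hx_main {Ω : Type*} [MetricSpace Ω] {m : ℕ} {A : Fin m → Set Ω}
    {lam : Fin m → ℝ} (hF : MemF m A lam) (hint : InternallyConnectedFamily A)
    {f : Ω → ℝ} (hf : Continuous f) {e : ℝ} (he : 0 ≤ e)
    (hfe : ∀ x, |pwConst m A lam x - f x| ≤ e) (x y : Ω) :
    |mergeHeight {C | SatisfiesAxioms m A lam C} (heightFn (pwConst m A lam)) x y -
      mergeHeight (HartiganTree f) (heightFn f) x y| ≤ e := by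
  obtain ⟨hl, hd, -, hconn, hconni, -⟩ := hF
  rw [abs_le]
  constructor
  · suffices h : mergeHeight (HartiganTree f) (heightFn f) x y ≤
        mergeHeight {C | SatisfiesAxioms m A lam C} (heightFn (pwConst m A lam)) x y + e by
      linarith
    have hnn := hx_tree_nonneg (A := A) hl {C | SatisfiesAxioms m A lam C} x y
    apply Real.sSup_le _ (by linarith)
    rintro _ ⟨C, hC, hxC, hyC, rfl⟩
    obtain ⟨hpos, hbdd, hpre⟩ := hx_hart_height hC
    set s := heightFn f C with hs
    rcases le_or_gt (s - e) 0 with hse | hse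
    · linarith
    have hsf : ∀ z ∈ C, s - e ≤ pwConst m A lam z := by
      intro z hz
      have h1 : s ≤ f z := csInf_le hbdd ⟨z, hz, rfl⟩
      have h2 := abs_le.1 (hfe z)
      linarith [h2.1]
    have hcov : ∀ z ∈ C, ∃ i, z ∈ A i ∧ s - e ≤ lam i := by
      intro z hz
      obtain ⟨i, hi⟩ := hx_pw_pos (lt_of_lt_of_le hse (hsf z hz))
      exact ⟨i, hi, by rw [← hx_pw_eq (lam := lam) hd hi]; exact hsf z hz⟩
    obtain ⟨i, hxi, hi⟩ := hcov x hxC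
    obtain ⟨j, hyj, hj⟩ := hcov y hyC
    have hij : Relation.ReflTransGen
      (fun a b => s - e ≤ lam a ∧ s - e ≤ lam b ∧ Neighbors (A a) (A b)) i j := by
      by_contra hij
      set R : Fin m → Fin m → Prop :=
        fun a b => s - e ≤ lam a ∧ s - e ≤ lam b ∧ Neighbors (A a) (A b) with hR
      set I : Set (Fin m) := {k | Relation.ReflTransGen R i k} with hI
      set J : Set (Fin m) := {k | s - e ≤ lam k ∧ k ∉ I} with hJ
      have hIt : ∀ k ∈ I, s - e ≤ lam k := by
        intro k hk
        rcases Relation.ReflTransGen.cases_tail hk with h | ⟨c, _, h⟩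
        · rw [h]; exact hi
        · exact h.2.1
      have hii : i ∈ I := Relation.ReflTransGen.refl
      have hjJ : j ∈ J := ⟨hj, hij⟩
      have hcl : ∀ I : Set (Fin m), IsClosed (⋃ k ∈ I, closure (A k)) := fun I =>
        (Set.toFinite I).isClosed_biUnion fun _ _ => isClosed_closure
      have := isPreconnected_closed_iff.1 hpre _ _ (hcl I) (hcl J) (by
        intro z hz
        obtain ⟨k, hzk, hk⟩ := hcov z hz
        by_cases hkI : k ∈ I
        · exact Or.inl (mem_biUnion hkI (subset_closure hzk))
        · exact Or.inr (mem_biUnion (show k ∈ J from ⟨hk, hkI⟩) (subset_closure hzk)))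
        ⟨x, hxC, mem_biUnion hii (subset_closure hxi)⟩
        ⟨y, hyC, mem_biUnion hjJ (subset_closure hyj)⟩
      obtain ⟨z, _, hzI, hzJ⟩ := this
      obtain ⟨k, hk, hzk⟩ := mem_iUnion₂.1 hzI
      obtain ⟨l, hl', hzl⟩ := mem_iUnion₂.1 hzJ
      have hn : Neighbors (A k) (A l) :=
        hint k l (IsConnected.union ⟨z, hzk, hzl⟩ (hconn k).closure (hconn l).closure)
      exact hl'.2 (Relation.ReflTransGen.tail hk ⟨hIt k hk, hl'.1, hn⟩)
    have := hx_tree_lower hl hd hse hi hij hxi hyj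
    linarith
  · suffices h : mergeHeight {C | SatisfiesAxioms m A lam C}
        (heightFn (pwConst m A lam)) x y ≤
        mergeHeight (HartiganTree f) (heightFn f) x y + e by
      linarith
    have hnn := hx_hart_nonneg f x y
    apply Real.sSup_le _ (by linarith)
    rintro _ ⟨C, ⟨I, hCI, hchain, -⟩, hxC, hyC, rfl⟩
    set t := heightFn (pwConst m A lam) C with ht
    rcases le_or_gt (t - e) 0 with hte | hte
    · linarith
    have hIt : ∀ k ∈ I, ∀ z ∈ A k, t - e ≤ f z := by
      intro k hk z hz
      have hzC : z ∈ C := by rw [hCI]; exact mem_biUnion hk hz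
      have h1 : t ≤ pwConst m A lam z := csInf_le (hx_bddBelow hl C) ⟨z, hzC, rfl⟩
      have h2 := abs_le.1 (hfe z)
      linarith [h2.2]
    have hpre : IsPreconnected (⋃ k ∈ I, closure (A k)) := by
      apply IsPreconnected.biUnion_of_reflTransGen
      · intro k _; exact (hconn k).closure.isPreconnected
      · intro a ha b hb
        refine Relation.ReflTransGen.mono ?_ _ _ (hchain a ha b hb)
        rintro c d ⟨hc, _, hn⟩
        exact ⟨hx_neighbors_inter (hconni c).nonempty (hconni d).nonempty hn, hc⟩
    have hCK : C ⊆ ⋃ k ∈ I, closure (A k) := by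
      rw [hCI]; exact biUnion_mono subset_rfl fun _ _ => subset_closure
    have := hx_hart_lower (f := f) hpre hte (by
      intro z hz
      obtain ⟨k, hk, hzk⟩ := mem_iUnion₂.1 hz
      have hcl : IsClosed {z | t - e ≤ f z} := isClosed_le continuous_const hf
      exact closure_minimal (fun w hw => hIt k hk w hw) hcl hzk) (hCK hxC) (hCK hyC)
    linarith

lemma hx_hart_tree {Ω : Type*} [TopologicalSpace Ω] (f : Ω → ℝ) :
    IsClusterTree f (HartiganTree f) := by
  constructor
  · rintro _ ⟨l, hl, x, hx, rfl⟩
    refine ⟨fun z hz => subset_closure ?_, isConnected_connectedComponentIn_iff.2 hx⟩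
    have : l ≤ f z := connectedComponentIn_subset {y | l ≤ f y} x hz
    exact (lt_of_lt_of_le hl this).ne'
  · have key : ∀ (l l' : ℝ) (x x' : Ω), l ≤ l' →
        Disjoint (connectedComponentIn {y | l ≤ f y} x) (connectedComponentIn {y | l' ≤ f y} x') ∨
        connectedComponentIn {y | l' ≤ f y} x' ⊆ connectedComponentIn {y | l ≤ f y} x := by
      intro l l' x x' hll
      by_cases h : Disjoint (connectedComponentIn {y | l ≤ f y} x)
        (connectedComponentIn {y | l' ≤ f y} x')
      · exact Or.inl h
      · right
        obtain ⟨z, hz, hz'⟩ := Set.not_disjoint_iff.1 h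
        rw [connectedComponentIn_eq hz]
        exact isPreconnected_connectedComponentIn.subset_connectedComponentIn hz'
          fun w hw => hll.trans (connectedComponentIn_subset {y | l' ≤ f y} x' hw)
    rintro _ ⟨l, hl, x, hx, rfl⟩ _ ⟨l', hl', x', hx', rfl⟩
    rcases le_total l l' with h | h
    · rcases key l l' x x' h with h | h
      · exact Or.inl h
      · exact Or.inr (Or.inr h)
    · rcases key l' l x' x h with h | h
      · exact Or.inl h.symm
      · exact Or.inr (Or.inl h)

/-- If a continuous function `f : Ω → [0, ∞)` whose support has connected interior
admits an axiom cluster tree, then the Hartigan tree `H_f` (with height `h_f`) is itself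
an axiom cluster tree for `f`. -/
theorem hartigan_is_axiom_cluster_tree {Ω : Type*} [MetricSpace Ω]
    [LocallyConnectedSpace Ω] (f : Ω → ℝ) (hf_cont : Continuous f)
    (hf_nonneg : ∀ x, 0 ≤ f x)
    (hf_supp : IsConnected (interior (closure (Function.support f))))
    (h_exists : ∃ T : Set (Set Ω), IsAxiomClusterTree f T) :
    IsAxiomClusterTree f (HartiganTree f) := by
  obtain ⟨T, -, fn, Tn, hmem, hsup, -⟩ := h_exists
  refine ⟨hx_hart_tree f, fn, Tn, hmem, hsup, ?_⟩
  refine tendsto_of_tendsto_of_tendsto_of_le_of_le tendsto_const_nhds hsup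
    (fun n => zero_le) fun n => ?_
  show mergeDistortion (Tn n) (heightFn (fn n)) (HartiganTree f) (heightFn f) ≤
    supDist (fn n) f
  obtain ⟨m, A, lam, hF, hint, hg, hT⟩ := hmem n
  rw [hT, hg]
  by_cases htop : supDist (pwConst m A lam) f = ⊤
  · rw [htop]; exact le_top
  have hfe : ∀ x, |pwConst m A lam x - f x| ≤ (supDist (pwConst m A lam) f).toReal := by
    intro x
    have h1 : edist (pwConst m A lam x) (f x) ≤ supDist (pwConst m A lam) f :=
      le_iSup (fun x => edist (pwConst m A lam x) (f x)) x
    have h2 := ENNReal.toReal_mono htop h1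
    rwa [edist_dist, ENNReal.toReal_ofReal dist_nonneg, Real.dist_eq] at h2
  refine iSup_le fun x => iSup_le fun y => ?_
  rw [edist_dist, Real.dist_eq]
  exact ENNReal.ofReal_le_of_le_toReal
    (hx_main hF hint hf_cont ENNReal.toReal_nonneg hfe x y)
end

section
/- Let f : Ω → [0, ∞) be continuous with supp(f) having connected interior, and suppose f admits an axiom cluster tree. Then every axiom cluster tree 𝒞 for f satisfies d_M((𝒞, h_f), (H_f, h_f)) = 0. -/
open Set Topology Bornology ENNReal

lemma pw_mem {Ω : Type*} [MetricSpace Ω] {m : ℕ} {A : Fin m → Set Ω} {lam : Fin m → ℝ}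
    (hd : Pairwise fun i j => Disjoint (A i) (A j)) {i : Fin m} {x : Ω} (hx : x ∈ A i) :
    pwConst m A lam x = lam i := by
  unfold pwConst
  rw [Finset.sum_eq_single i]
  · simp [hx]
  · intro j _ hj
    have : x ∉ A j := fun h => Set.disjoint_left.1 (hd hj) h hx
    simp [this]
  · simp

lemma pw_not_mem {Ω : Type*} [MetricSpace Ω] {m : ℕ} {A : Fin m → Set Ω} {lam : Fin m → ℝ}
    {x : Ω} (hx : ∀ i, x ∉ A i) : pwConst m A lam x = 0 := by
  unfold pwConst
  exact Finset.sum_eq_zero fun i _ => by simp [hx i]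

lemma pw_nonneg {Ω : Type*} [MetricSpace Ω] {m : ℕ} {A : Fin m → Set Ω} {lam : Fin m → ℝ}
    (hl : ∀ i, 0 < lam i) (x : Ω) : 0 ≤ pwConst m A lam x := by
  unfold pwConst
  exact Finset.sum_nonneg fun i _ => Set.indicator_nonneg (fun _ _ => (hl i).le) _

lemma bddBelow_img {Ω : Type*} {g : Ω → ℝ} (hg : ∀ x, 0 ≤ g x) (C : Set Ω) :
    BddBelow (g '' C) := ⟨0, by rintro _ ⟨x, _, rfl⟩; exact hg x⟩

lemma heightFn_le {Ω : Type*} {g : Ω → ℝ} (hg : ∀ x, 0 ≤ g x) {C : Set Ω} {x : Ω}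
    (hx : x ∈ C) : heightFn g C ≤ g x :=
  csInf_le (bddBelow_img hg C) ⟨x, hx, rfl⟩

lemma heightFn_nonneg {Ω : Type*} {g : Ω → ℝ} (hg : ∀ x, 0 ≤ g x) (C : Set Ω) :
    0 ≤ heightFn g C := Real.sInf_nonneg (by rintro _ ⟨x, _, rfl⟩; exact hg x)

lemma merge_nonneg {Ω : Type*} {g : Ω → ℝ} (hg : ∀ x, 0 ≤ g x) (T : Set (Set Ω)) (x y : Ω) :
    0 ≤ mergeHeight T (heightFn g) x y :=
  Real.sSup_nonneg (by rintro _ ⟨C, _, _, _, rfl⟩; exact heightFn_nonneg hg C)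

lemma le_merge {Ω : Type*} {g : Ω → ℝ} (hg : ∀ x, 0 ≤ g x) {T : Set (Set Ω)} {x y : Ω}
    {C : Set Ω} (hC : C ∈ T) (hx : x ∈ C) (hy : y ∈ C) {s : ℝ} (hs : ∀ z ∈ C, s ≤ g z) :
    s ≤ mergeHeight T (heightFn g) x y := by
  refine le_trans (le_csInf ⟨_, x, hx, rfl⟩ ?_ : s ≤ heightFn g C) (le_csSup ?_ ⟨C, hC, hx, hy, rfl⟩)
  · rintro _ ⟨z, hz, rfl⟩; exact hs z hz
  · exact ⟨g x, by rintro _ ⟨D, _, hxD, _, rfl⟩; exact heightFn_le hg hxD⟩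

lemma merge_le {Ω : Type*} {g : Ω → ℝ} {T : Set (Set Ω)} {x y : Ω} {b : ℝ} (hb : 0 ≤ b)
    (h : ∀ C ∈ T, x ∈ C → y ∈ C → heightFn g C ≤ b) :
    mergeHeight T (heightFn g) x y ≤ b :=
  Real.sSup_le (by rintro _ ⟨C, hC, hx, hy, rfl⟩; exact h C hC hx hy) hb

lemma nbr_inter {Ω : Type*} [TopologicalSpace Ω] {A B : Set Ω} (h : Neighbors A B)
    (hA : (interior A).Nonempty) (hB : (interior B).Nonempty) :
    (closure A ∩ closure B).Nonempty := by
  have := isPreconnected_closed_iff.1 h.isPreconnected _ _ isClosed_closure isClosed_closure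
    interior_subset (?_ : (_ ∩ closure A).Nonempty) (?_ : (_ ∩ closure B).Nonempty)
  · exact this.mono inter_subset_right
  · obtain ⟨z, hz⟩ := hA
    exact ⟨z, interior_mono (subset_closure.trans subset_union_left) hz,
      subset_closure (interior_subset hz)⟩
  · obtain ⟨z, hz⟩ := hB
    exact ⟨z, interior_mono (subset_closure.trans subset_union_right) hz,
      subset_closure (interior_subset hz)⟩

lemma merge_upper {Ω : Type*} [MetricSpace Ω] {f g : Ω → ℝ} {T : Set (Set Ω)}
    (hf : Continuous f) (hf0 : ∀ x, 0 ≤ f x) (hT : MemFintWithTree g T) {ε : ℝ} (hε : 0 ≤ ε)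
    (h : ∀ x, |g x - f x| ≤ ε) (x y : Ω) :
    mergeHeight T (heightFn g) x y ≤ mergeHeight (HartiganTree f) (heightFn f) x y + ε := by
  obtain ⟨m, A, lam, ⟨hl, hd, -, hc, hci, -⟩, hint, rfl, rfl⟩ := hT
  have hg0 := pw_nonneg (A := A) hl
  refine merge_le (add_nonneg (merge_nonneg hf0 _ _ _) hε) ?_
  rintro C ⟨I, rfl, hch, -⟩ hx hy
  set t := heightFn (pwConst m A lam) (⋃ i ∈ I, A i) with ht
  rcases le_or_gt t ε with hte | hte
  · linarith [merge_nonneg hf0 (HartiganTree f) x y]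
  rw [← sub_le_iff_le_add]
  have hsub : (⋃ i ∈ I, closure (A i)) ⊆ {z | t - ε ≤ f z} := by
    refine iUnion₂_subset fun i hi => closure_minimal ?_ (isClosed_le continuous_const hf)
    intro z hz
    have h1 : t ≤ pwConst m A lam z := heightFn_le hg0 (mem_biUnion hi hz)
    have := abs_le.1 (h z)
    show t - ε ≤ f z; linarith
  have hpc : IsPreconnected (⋃ i ∈ I, closure (A i)) := by
    refine IsPreconnected.biUnion_of_reflTransGen
      (fun i _ => (hc i).isPreconnected.closure) fun i hi j hj => ?_
    refine Relation.ReflTransGen.mono ?_ _ _ (hch i hi j hj)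
    rintro a b ⟨ha, _, hab⟩
    exact ⟨nbr_inter hab (hci a).nonempty (hci b).nonempty, ha⟩
  have hcl : (⋃ i ∈ I, A i) ⊆ ⋃ i ∈ I, closure (A i) :=
    iUnion₂_mono fun i _ => subset_closure
  have hxx := hsub (hcl hx)
  have hCH : connectedComponentIn {z | t - ε ≤ f z} x ∈ HartiganTree f :=
    ⟨t - ε, by linarith, x, hxx, rfl⟩
  refine le_merge hf0 hCH (mem_connectedComponentIn hxx)
    (hpc.subset_connectedComponentIn (hcl hx) hsub (hcl hy)) ?_
  intro z hz
  exact (connectedComponentIn_subset {z | t - ε ≤ f z} x hz : z ∈ {z | t - ε ≤ f z})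

lemma merge_lower {Ω : Type*} [MetricSpace Ω] {f g : Ω → ℝ} {T : Set (Set Ω)}
    (hf0 : ∀ x, 0 ≤ f x) (hT : MemFintWithTree g T) {ε : ℝ} (hε : 0 ≤ ε)
    (h : ∀ x, |g x - f x| ≤ ε) (x y : Ω) :
    mergeHeight (HartiganTree f) (heightFn f) x y ≤ mergeHeight T (heightFn g) x y + ε := by
  obtain ⟨m, A, lam, ⟨hl, hd, -, hc, hci, -⟩, hint, rfl, rfl⟩ := hT
  have hg0 := pw_nonneg (A := A) hl
  refine merge_le (add_nonneg (merge_nonneg hg0 _ _ _) hε) ?_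
  intro C hC hx hy
  have hCc : IsPreconnected C := by
    obtain ⟨_, _, _, _, rfl⟩ := hC
    exact isPreconnected_connectedComponentIn
  set t := heightFn f C with ht
  rcases le_or_gt t ε with hte | hte
  · linarith [merge_nonneg hg0 {C | SatisfiesAxioms m A lam C} x y]
  rw [← sub_le_iff_le_add]
  have hs : 0 < t - ε := by linarith
  have hCs : ∀ z ∈ C, t - ε ≤ pwConst m A lam z := by
    intro z hz
    have h1 : t ≤ f z := heightFn_le hf0 hz
    have := abs_le.1 (h z)
    linarith
  clear_value t
  generalize t - ε = s at *
  have hreg : ∀ z ∈ C, ∃ i, z ∈ A i ∧ s ≤ lam i := by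
    intro z hz
    by_contra! hcon
    have h1 := hCs z hz
    by_cases hz' : ∃ i, z ∈ A i
    · obtain ⟨i, hi⟩ := hz'
      rw [pw_mem hd hi] at h1
      linarith [hcon i hi]
    · push Not at hz'
      rw [pw_not_mem hz'] at h1
      linarith
  obtain ⟨i₀, hxi, hsi⟩ := hreg x hx
  set R : Fin m → Fin m → Prop := fun a b => s ≤ lam a ∧ s ≤ lam b ∧ Neighbors (A a) (A b)
    with hR
  set J : Set (Fin m) := {i | Relation.ReflTransGen R i₀ i} with hJ
  have hJs : ∀ i ∈ J, s ≤ lam i := by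
    intro i hi
    rcases Relation.ReflTransGen.cases_tail hi with rfl | ⟨_, _, hb⟩
    · exact hsi
    · exact hb.2.1
  have hyJ : y ∈ ⋃ i ∈ J, A i := by
    obtain ⟨k, hyk, hsk⟩ := hreg y hy
    by_cases hk : k ∈ J
    · exact mem_biUnion hk hyk
    exfalso
    obtain ⟨z, -, hz1, hz2⟩ := isPreconnected_closed_iff.1 hCc (⋃ i ∈ J, closure (A i))
      (⋃ i ∈ {i | s ≤ lam i ∧ i ∉ J}, closure (A i))
      ((Set.toFinite _).isClosed_biUnion fun _ _ => isClosed_closure)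
      ((Set.toFinite _).isClosed_biUnion fun _ _ => isClosed_closure)
      (by
        intro z hz
        obtain ⟨i, hzi, hi⟩ := hreg z hz
        by_cases hiJ : i ∈ J
        · exact Or.inl (mem_biUnion hiJ (subset_closure hzi))
        · exact Or.inr (mem_biUnion (show i ∈ {i | s ≤ lam i ∧ i ∉ J} from ⟨hi, hiJ⟩)
            (subset_closure hzi)))
      ⟨x, hx, mem_biUnion (show i₀ ∈ J from Relation.ReflTransGen.refl) (subset_closure hxi)⟩
      ⟨y, hy, mem_biUnion (show k ∈ {i | s ≤ lam i ∧ i ∉ J} from ⟨hsk, hk⟩)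
            (subset_closure hyk)⟩
    simp only [mem_iUnion] at hz1 hz2
    obtain ⟨a, ha, hza⟩ := hz1
    obtain ⟨b, ⟨hb, hbJ⟩, hzb⟩ := hz2
    refine hbJ (Relation.ReflTransGen.tail ha ⟨hJs a ha, hb, hint a b ?_⟩)
    exact IsConnected.union ⟨z, hza, hzb⟩ (hc a).closure (hc b).closure
  have hgJ : ∀ z ∈ ⋃ i ∈ J, A i, s ≤ pwConst m A lam z := by
    intro z hz
    simp only [mem_iUnion] at hz
    obtain ⟨i, hi, hzi⟩ := hz
    rw [pw_mem hd hzi]; exact hJs i hi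
  have hxJ : x ∈ ⋃ i ∈ J, A i :=
    mem_biUnion (show i₀ ∈ J from Relation.ReflTransGen.refl) hxi
  suffices hsat : (⋃ i ∈ J, A i) ∈ {C | SatisfiesAxioms m A lam C} from
    le_merge hg0 hsat hxJ hyJ hgJ
  refine ⟨J, rfl, ?_, ?_⟩
  · have hRs : Std.Symm R := ⟨by
      rintro a b ⟨h1, h2, h3⟩
      exact ⟨h2, h1, by unfold Neighbors at *; rwa [union_comm]⟩⟩
    have key : ∀ i j, i ∈ J → Relation.ReflTransGen R i j →
        Relation.ReflTransGen (fun a b => a ∈ J ∧ b ∈ J ∧ Neighbors (A a) (A b)) i j := by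
      intro i j hi hij
      induction hij with
      | refl => exact .refl
      | tail hab hbc ih =>
        exact ih.tail ⟨Relation.ReflTransGen.trans hi hab,
          Relation.ReflTransGen.tail (Relation.ReflTransGen.trans hi hab) hbc, hbc.2.2⟩
    intro i hi j hj
    exact key i j hi (Relation.ReflTransGen.trans ((Relation.ReflTransGen.stdSymm (r := R)).symm _ _ hi) hj)
  · have hinf : s ≤ sInf (pwConst m A lam '' (⋃ i ∈ J, A i)) :=
      le_csInf ⟨_, x, hxJ, rfl⟩ (by rintro _ ⟨z, hz, rfl⟩; exact hgJ z hz)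
    refine lt_of_lt_of_le ?_ hinf
    set S := pwConst m A lam '' ((⋃ i ∈ J, regionNbhd A i) \ ⋃ i ∈ J, A i) with hS
    have hSe : ∀ v ∈ S, v < s ∧ v ∈ Set.range lam := by
      rintro _ ⟨z, ⟨hz1, hz2⟩, rfl⟩
      simp only [regionNbhd, mem_iUnion] at hz1
      obtain ⟨i, hi, j, hj, hzj⟩ := hz1
      rw [pw_mem hd hzj]
      refine ⟨?_, j, rfl⟩
      by_contra! hcon
      exact hz2 (mem_biUnion (show j ∈ J from
        Relation.ReflTransGen.tail hi ⟨hJs i hi, hcon, hj⟩) hzj)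
    rcases S.eq_empty_or_nonempty with he | hne
    · rw [he, Real.sSup_empty]; exact hs
    · have hfin : S.Finite := (Set.finite_range lam).subset fun v hv => (hSe v hv).2
      exact (hSe _ (hne.csSup_mem hfin)).1

lemma edist_merge {Ω : Type*} [MetricSpace Ω] {f g : Ω → ℝ} {T : Set (Set Ω)}
    (hf : Continuous f) (hf0 : ∀ x, 0 ≤ f x) (hT : MemFintWithTree g T) (x y : Ω) :
    edist (mergeHeight T (heightFn g) x y) (mergeHeight (HartiganTree f) (heightFn f) x y)
      ≤ supDist g f := by
  by_cases htop : supDist g f = ⊤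
  · rw [htop]; exact le_top
  have h : ∀ x, |g x - f x| ≤ (supDist g f).toReal := by
    intro x
    rw [← Real.dist_eq, ← ENNReal.ofReal_le_iff_le_toReal htop, ← edist_dist]
    exact le_iSup (fun x => edist (g x) (f x)) x
  rw [edist_dist, ENNReal.ofReal_le_iff_le_toReal htop, Real.dist_eq, abs_le]
  have h1 := merge_upper hf hf0 hT ENNReal.toReal_nonneg h x y
  have h2 := merge_lower hf0 hT ENNReal.toReal_nonneg h x y
  constructor <;> linarith

/-- If a continuous function `f : Ω → [0, ∞)` whose support has connected interior
admits an axiom cluster tree, then every axiom cluster tree `𝒞` for `f` is at merge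
distortion distance zero from the Hartigan tree:
`d_M((𝒞, h_f), (H_f, h_f)) = 0`. -/
theorem axiom_cluster_tree_merge_dist_zero {Ω : Type*} [MetricSpace Ω]
    [LocallyConnectedSpace Ω] (f : Ω → ℝ) (hf_cont : Continuous f)
    (hf_nonneg : ∀ x, 0 ≤ f x)
    (hf_supp : IsConnected (interior (closure (Function.support f))))
    (h_exists : ∃ T : Set (Set Ω), IsAxiomClusterTree f T) :
    ∀ T : Set (Set Ω), IsAxiomClusterTree f T →
      mergeDistortion T (heightFn f) (HartiganTree f) (heightFn f) = 0 := by
  rintro T ⟨-, fn, Tn, hm, h1, h2⟩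
  unfold mergeDistortion
  simp only [ENNReal.iSup_eq_zero]
  intro x y
  have h3 := h2.add h1
  rw [add_zero] at h3
  refine le_antisymm (ge_of_tendsto' h3 fun n => ?_) bot_le
  refine (edist_triangle_left _ _ (mergeHeight (Tn n) (heightFn (fn n)) x y)).trans ?_
  refine add_le_add ?_ (edist_merge hf_cont hf_nonneg (hm n) x y)
  exact le_iSup₂ (f := fun x y => edist (mergeHeight (Tn n) (heightFn (fn n)) x y)
    (mergeHeight T (heightFn f) x y)) x y
end
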